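/- Let p be an odd prime, n an even positive integer, s a positive integer with s ≤ n/2, and ε ∈ {1,−1}. Let {A_i : i ∈ V_s} be a partition of V_n into nonempty sets and let F : V_n → V_s be the function with F(x) = i iff x ∈ A_i. Then the following are equivalent. (1) The partition is a bent partition satisfying Condition C with sign ε, i.e.: (a) a•A_i = A_i for every a ∈ (ZMod p)ˣ and every i ∈ V_s, and (b) for every g : V_s → ZMod p each of whose fibers has exactly p^{s−1} elements, g ∘ F is weakly regular bent with sign ε. (2) For every nonempty subset I ⊆ V_s, the set A_I = ⋃_{i ∈ I} A_i satisfies −A_I = A_I, and A_I \ {0} is a (p^n, k, λ, μ) partial difference set in the additive group V_n, where if 0 ∈ A_I then (k, λ, μ) is parameter set (35) for |I| and ε, and if 0 ∉ A_I then (k, λ, μ) is parameter set (36) for |I| and ε. -/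

import Mathlib

open Finset

/-- `ζ_p^t = exp(2πi·t.val/p)` for `t : ZMod p`. -/
noncomputable def zetaP (p : ℕ) (t : ZMod p) : ℂ :=
  Complex.exp (2 * Real.pi * Complex.I * (t.val : ℂ) / (p : ℂ))

/-- The standard inner product on `V_n = Fin n → ZMod p`. -/
def ip {p n : ℕ} (a x : Fin n → ZMod p) : ZMod p := ∑ i, a i * x i

/-- The Walsh transform of `f : V_n → ZMod p`. -/
noncomputable def walsh {p n : ℕ} [NeZero p] (f : (Fin n → ZMod p) → ZMod p)
    (a : Fin n → ZMod p) : ℂ :=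
  ∑ x : Fin n → ZMod p, zetaP p (f x - ip a x)

/-- `f : V_n → ZMod p` is weakly regular bent with sign `ε`. -/
def WeaklyRegularBent {n : ℕ} (p : ℕ) [NeZero p]
    (f : (Fin n → ZMod p) → ZMod p) (ε : ℤ) : Prop :=
  ∃ fd : (Fin n → ZMod p) → ZMod p,
    ∀ a : Fin n → ZMod p, walsh f a = (ε : ℂ) * (p : ℂ) ^ (n / 2) * zetaP p (fd a)

/-- `D` is a `(v, k, λ, μ)` partial difference set (with `klm = (k, λ, μ)`) in the finite
abelian group `G`. -/
def IsPDS {G : Type*} [AddCommGroup G] [Fintype G] [DecidableEq G]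
    (D : Finset G) (v : ℤ) (klm : ℤ × ℤ × ℤ) : Prop :=
  (Fintype.card G : ℤ) = v ∧ (D.card : ℤ) = klm.1 ∧
  (∀ g ∈ D, g ≠ 0 →
    ((((D ×ˢ D).filter (fun dd => dd.1 - dd.2 = g)).card : ℤ) = klm.2.1)) ∧
  (∀ g ∉ D, g ≠ (0 : G) →
    ((((D ×ˢ D).filter (fun dd => dd.1 - dd.2 = g)).card : ℤ) = klm.2.2))

/-- Parameter set (35) for `|I| = cI` and `ε`. -/
def param35 (p n s : ℕ) (ε cI : ℤ) : ℤ × ℤ × ℤ :=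
  ((p : ℤ) ^ (n - s) * cI + ε * (p : ℤ) ^ (n / 2 - s) * ((p : ℤ) ^ s - cI) - 1,
   (p : ℤ) ^ (n - 2 * s) * cI ^ 2 + ε * (p : ℤ) ^ (n / 2 - s) * ((p : ℤ) ^ s - cI) - 2,
   (p : ℤ) ^ (n - 2 * s) * cI ^ 2 + ε * (p : ℤ) ^ (n / 2 - s) * cI)

/-- Parameter set (36) for `|I| = cI` and `ε`. -/
def param36 (p n s : ℕ) (ε cI : ℤ) : ℤ × ℤ × ℤ :=
  ((p : ℤ) ^ (n - s) * cI - ε * (p : ℤ) ^ (n / 2 - s) * cI,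
   (p : ℤ) ^ (n - 2 * s) * cI ^ 2 + ε * (p : ℤ) ^ (n / 2 - s) * ((p : ℤ) ^ s - 3 * cI),
   (p : ℤ) ^ (n - 2 * s) * cI ^ 2 - ε * (p : ℤ) ^ (n / 2 - s) * cI)

open scoped Matrix

section Characters

variable {p : ℕ} [Fact p.Prime] {n : ℕ}

theorem zetaP_eq_stdAddChar (t : ZMod p) : zetaP p t = ZMod.stdAddChar t := by
  rw [ZMod.stdAddChar_apply, ZMod.toCircle_apply, zetaP]

theorem zetaP_zero : zetaP p 0 = 1 := by
  rw [zetaP_eq_stdAddChar, AddChar.map_zero_eq_one]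

theorem zetaP_add (s t : ZMod p) : zetaP p (s + t) = zetaP p s * zetaP p t := by
  simp only [zetaP_eq_stdAddChar, AddChar.map_add_eq_mul]

theorem sum_zetaP_mul (t : ZMod p) :
    ∑ c : ZMod p, zetaP p (c * t) = if t = 0 then (p : ℂ) else 0 := by
  simp only [zetaP_eq_stdAddChar]
  rw [AddChar.sum_mulShift t (ZMod.isPrimitive_stdAddChar p), ZMod.card]
  split_ifs <;> simp

theorem sum_zetaP : ∑ c : ZMod p, zetaP p c = 0 := by
  simpa using sum_zetaP_mul (p := p) 1

theorem isPrimitiveRoot_zetaP_one : IsPrimitiveRoot (zetaP p 1) p := by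
  have hp : p.Prime := Fact.out
  rw [zetaP, ZMod.val_one, Nat.cast_one, mul_one]
  exact Complex.isPrimitiveRoot_exp p hp.ne_zero

theorem zetaP_eq_pow (t : ZMod p) : zetaP p t = zetaP p 1 ^ t.val := by
  rw [zetaP_eq_stdAddChar, zetaP_eq_stdAddChar, ← AddChar.map_nsmul_eq_pow]
  simp

/-- The only rational linear relation between the `p`-th roots of unity says that their sum
vanishes. -/
theorem eq_of_sum_zetaP_eq_zero {c : ZMod p → ℚ} (h : ∑ j, (c j : ℂ) * zetaP p j = 0)
    (j k : ZMod p) : c j = c k := by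
  have hp : p.Prime := Fact.out
  let Q : Polynomial ℚ := ∑ i ∈ Finset.range p, Polynomial.C (c (i : ZMod p)) * Polynomial.X ^ i
  have hcoeff (i : ZMod p) : Q.coeff i.val = c i := by
    simp [Q, Polynomial.finsetSum_coeff, Polynomial.coeff_X_pow, ZMod.val_lt i]
  have hroot : Polynomial.aeval (zetaP p 1) Q = 0 := by
    rw [← h]
    simp only [Q, map_sum, map_mul, Polynomial.aeval_C, map_pow, Polynomial.aeval_X]
    refine Finset.sum_bij' (fun i _ => (i : ZMod p)) (fun i _ => i.val) ?_ ?_ ?_ ?_ ?_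
    · simp
    · simp [ZMod.val_lt]
    · intro i hi
      exact ZMod.val_cast_of_lt (Finset.mem_range.1 hi)
    · simp
    · intro i hi
      rw [zetaP_eq_pow (i : ZMod p), ZMod.val_cast_of_lt (Finset.mem_range.1 hi)]
      simp
  have hdvd : Polynomial.cyclotomic p ℚ ∣ Q := by
    rw [Polynomial.cyclotomic_eq_minpoly_rat isPrimitiveRoot_zetaP_one hp.pos]
    exact minpoly.dvd ℚ _ hroot
  obtain ⟨R, hR⟩ := hdvd
  have hQdeg : Q.degree < p := by
    refine (Polynomial.degree_sum_le _ _).trans_lt ?_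
    rw [Finset.sup_lt_iff (by simp)]
    intro i hi
    exact (Polynomial.degree_C_mul_X_pow_le _ _).trans_lt (by simpa using hi)
  have hRdeg : R.degree ≤ 0 := by
    by_cases hR0 : R = 0
    · simp [hR0]
    · have hc0 := Polynomial.cyclotomic_ne_zero p ℚ
      rw [hR, Polynomial.degree_mul, Polynomial.degree_eq_natDegree hc0,
        Polynomial.degree_eq_natDegree hR0, Polynomial.natDegree_cyclotomic,
        Nat.totient_prime hp] at hQdeg
      have hlt : p - 1 + R.natDegree < p := by exact_mod_cast hQdeg
      have hle : R.natDegree ≤ 0 := by have := hp.two_le; omega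
      exact Polynomial.natDegree_le_iff_degree_le.1 hle
  rw [Polynomial.eq_C_of_degree_le_zero hRdeg, Polynomial.cyclotomic_prime] at hR
  have hconst (i : ZMod p) : c i = R.coeff 0 := by
    rw [← hcoeff i, hR, Polynomial.coeff_mul_C, Polynomial.finsetSum_coeff]
    simp [Polynomial.coeff_X_pow, ZMod.val_lt i]
  rw [hconst, hconst]

/-- A rational value of `∑ j, c j ζ^j` is unchanged when `ζ` is replaced by a conjugate. -/
theorem sum_zetaP_mul_eq_of_rat {c : ZMod p → ℚ} {q : ℚ}
    (h : ∑ j, (c j : ℂ) * zetaP p j = q) {u : ZMod p} (hu : u ≠ 0) :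
    ∑ j, (c j : ℂ) * zetaP p (u * j) = q := by
  set d : ZMod p → ℚ := fun j => c j - if j = 0 then q else 0 with hd
  have hsum : ∑ j, (d j : ℂ) * zetaP p j = 0 := by
    simp [hd, sub_mul, Finset.sum_sub_distrib, h, zetaP_zero, apply_ite (Rat.cast : ℚ → ℂ)]
  have hconst (j : ZMod p) : c j = d 0 + if j = 0 then q else 0 := by
    rw [eq_of_sum_zetaP_eq_zero hsum 0 j]
    simp [hd]
  have hmul : ∑ j, zetaP p (u * j) = 0 := by
    simpa [hu, mul_comm] using sum_zetaP_mul u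
  calc ∑ j, (c j : ℂ) * zetaP p (u * j)
      = ∑ j, ((d 0 : ℂ) * zetaP p (u * j) + if j = 0 then (q : ℂ) else 0) := by
        refine Finset.sum_congr rfl fun j _ => ?_
        rw [hconst j]
        by_cases hj : j = 0 <;> simp [hj, zetaP_zero]
    _ = q := by
        rw [Finset.sum_add_distrib, ← Finset.mul_sum, hmul]
        simp

end Characters

section Fourier

variable {p : ℕ} [Fact p.Prime] {n : ℕ}

theorem ip_eq_dotProduct (a x : Fin n → ZMod p) : ip a x = a ⬝ᵥ x := rfl

theorem ip_zero_left (x : Fin n → ZMod p) : ip 0 x = 0 := zero_dotProduct x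

theorem ip_zero_right (a : Fin n → ZMod p) : ip a 0 = 0 := dotProduct_zero a

theorem ip_neg_right (a x : Fin n → ZMod p) : ip a (-x) = -ip a x := dotProduct_neg a x

theorem ip_sub_right (a x y : Fin n → ZMod p) : ip a (x - y) = ip a x - ip a y :=
  dotProduct_sub a x y

theorem ip_smul_left (c : ZMod p) (a x : Fin n → ZMod p) : ip (c • a) x = c * ip a x :=
  smul_dotProduct c a x

theorem ip_smul_right (c : ZMod p) (a x : Fin n → ZMod p) : ip a (c • x) = c * ip a x :=
  dotProduct_smul c a x

theorem ip_comm (a x : Fin n → ZMod p) : ip a x = ip x a := dotProduct_comm a x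

theorem sum_zetaP_ip (y : Fin n → ZMod p) :
    ∑ a, zetaP p (ip a y) = if y = 0 then (p : ℂ) ^ n else 0 := by
  let φ : (Fin n → ZMod p) →+ ZMod p :=
    { toFun := fun a => ip a y
      map_zero' := ip_zero_left y
      map_add' := fun a b => add_dotProduct a b y }
  let χ : AddChar (Fin n → ZMod p) ℂ := (ZMod.stdAddChar (N := p)).compAddMonoidHom φ
  have hχ (a : Fin n → ZMod p) : zetaP p (ip a y) = χ a := zetaP_eq_stdAddChar _
  classical
  simp only [hχ]
  rw [AddChar.sum_eq_ite]
  have hiff : χ = 0 ↔ y = 0 := by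
    rw [AddChar.eq_zero_iff]
    constructor
    · intro h
      ext i
      have hi := h (Pi.single i 1)
      rw [← hχ, ip_eq_dotProduct, single_one_dotProduct, ← zetaP_zero (p := p),
        zetaP_eq_stdAddChar, zetaP_eq_stdAddChar] at hi
      exact ZMod.injective_stdAddChar hi
    · rintro rfl a
      rw [← hχ, ip_zero_right, zetaP_zero]
  simp [hiff]

/-- The Fourier transform of a complex function on `V_n`. -/
noncomputable def fourierSum (f : (Fin n → ZMod p) → ℂ) (a : Fin n → ZMod p) : ℂ :=
  ∑ x, f x * zetaP p (-ip a x)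

theorem sum_fourierSum_mul (f : (Fin n → ZMod p) → ℂ) (y : Fin n → ZMod p) :
    ∑ a, fourierSum f a * zetaP p (ip a y) = (p : ℂ) ^ n * f y := by
  simp only [fourierSum, Finset.sum_mul]
  rw [Finset.sum_comm]
  have h (x : Fin n → ZMod p) :
      ∑ a, f x * zetaP p (-ip a x) * zetaP p (ip a y) = if x = y then (p : ℂ) ^ n * f x else 0 := by
    have h1 (a : Fin n → ZMod p) :
        f x * zetaP p (-ip a x) * zetaP p (ip a y) = f x * zetaP p (ip a (y - x)) := by
      rw [mul_assoc, ← zetaP_add, ip_sub_right, neg_add_eq_sub]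
    simp only [h1]
    rw [← Finset.mul_sum, sum_zetaP_ip]
    by_cases hxy : x = y
    · simp [hxy, mul_comm]
    · simp [hxy, sub_eq_zero, Ne.symm hxy]
  simp [h]

theorem fourierSum_injective :
    Function.Injective (fourierSum : ((Fin n → ZMod p) → ℂ) → (Fin n → ZMod p) → ℂ) := by
  intro f g h
  have hp : (p : ℂ) ≠ 0 := Nat.cast_ne_zero.2 (Fact.out : p.Prime).ne_zero
  ext y
  refine mul_left_cancel₀ (pow_ne_zero n hp) ?_
  rw [← sum_fourierSum_mul, ← sum_fourierSum_mul, h]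

/-- The character sums `χ_a(D)` of a subset `D` of `V_n`. -/
noncomputable def setSum (D : Finset (Fin n → ZMod p)) (a : Fin n → ZMod p) : ℂ :=
  ∑ x ∈ D, zetaP p (-ip a x)

theorem fourierSum_indicator (D : Finset (Fin n → ZMod p)) (a : Fin n → ZMod p) :
    fourierSum (fun x => if x ∈ D then 1 else 0) a = setSum D a := by
  simp [fourierSum, setSum]

theorem setSum_injective :
    Function.Injective (setSum : Finset (Fin n → ZMod p) → (Fin n → ZMod p) → ℂ) := by
  intro D E h
  have h1 := fourierSum_injective (p := p) (n := n)
    (a₁ := fun x => if x ∈ D then 1 else 0) (a₂ := fun x => if x ∈ E then 1 else 0)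
    (by ext a; rw [fourierSum_indicator, fourierSum_indicator, h])
  ext x
  have hx := congrFun h1 x
  by_cases hD : x ∈ D <;> by_cases hE : x ∈ E <;> simp [hD, hE] at hx ⊢

theorem setSum_zero (D : Finset (Fin n → ZMod p)) : setSum D 0 = D.card := by
  simp [setSum, ip_zero_left, zetaP_zero]

theorem setSum_univ (a : Fin n → ZMod p) :
    setSum Finset.univ a = if a = 0 then (p : ℂ) ^ n else 0 := by
  have h : setSum Finset.univ a = ∑ x, zetaP p (ip x (-a)) := by
    refine Finset.sum_congr rfl fun x _ => ?_
    rw [ip_neg_right, ip_comm]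
  rw [h, sum_zetaP_ip]
  simp

theorem setSum_erase_zero {D : Finset (Fin n → ZMod p)} (h : 0 ∈ D) (a : Fin n → ZMod p) :
    setSum (D.erase 0) a = setSum D a - 1 := by
  rw [setSum, setSum, ← Finset.sum_erase_add _ _ h, ip_zero_right, neg_zero, zetaP_zero,
    add_sub_cancel_right]

theorem setSum_biUnion {ι : Type*} [DecidableEq ι] {A : ι → Finset (Fin n → ZMod p)}
    (hA : Pairwise fun i j => Disjoint (A i) (A j)) (I : Finset ι) (a : Fin n → ZMod p) :
    setSum (I.biUnion A) a = ∑ i ∈ I, setSum (A i) a :=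
  Finset.sum_biUnion fun _ _ _ _ hij => hA hij

theorem setSum_eq_sum_fiber (D : Finset (Fin n → ZMod p)) (a : Fin n → ZMod p) (c : ZMod p) :
    setSum D (c • a) =
      ∑ j, (((D.filter fun x => -ip a x = j).card : ℚ) : ℂ) * zetaP p (c * j) := by
  rw [setSum, ← Finset.sum_fiberwise D (fun x => -ip a x)]
  refine Finset.sum_congr rfl fun j _ => ?_
  rw [Finset.sum_congr rfl (g := fun _ => zetaP p (c * j))]
  · simp
  · intro x hx
    rw [ip_smul_left, ← (Finset.mem_filter.1 hx).2, mul_neg]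

theorem setSum_image_smul (D : Finset (Fin n → ZMod p)) (u : (ZMod p)ˣ) (a : Fin n → ZMod p) :
    setSum (D.image fun x => (u : ZMod p) • x) a = setSum D ((u : ZMod p) • a) := by
  rw [setSum, Finset.sum_image]
  · simp only [ip_smul_left, ip_smul_right, setSum]
  · intro x _ y _ h
    exact (smul_right_injective _ u.ne_zero) h

/-- If all character sums of `D` are rational, then `D` is invariant under scaling. -/
theorem image_smul_eq_of_setSum_rat {D : Finset (Fin n → ZMod p)}
    (h : ∀ a, ∃ q : ℚ, setSum D a = q) (u : (ZMod p)ˣ) :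
    (D.image fun x => (u : ZMod p) • x) = D := by
  refine setSum_injective (funext fun a => ?_)
  obtain ⟨q, hq⟩ := h a
  rw [setSum_image_smul, setSum_eq_sum_fiber, hq]
  refine sum_zetaP_mul_eq_of_rat ?_ u.ne_zero
  have h1 := setSum_eq_sum_fiber D a 1
  simp only [one_smul, one_mul, hq] at h1
  exact h1.symm

/-- The character sums of a set which is invariant under scaling are rational. -/
theorem exists_rat_setSum {D : Finset (Fin n → ZMod p)}
    (h : ∀ u : (ZMod p)ˣ, (D.image fun x => (u : ZMod p) • x) = D) (a : Fin n → ZMod p) :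
    ∃ q : ℚ, setSum D a = q := by
  have hp : p.Prime := Fact.out
  have hinv (c : ZMod p) (hc : c ≠ 0) : setSum D (c • a) = setSum D a := by
    conv_rhs => rw [← h (Units.mk0 c hc)]
    rw [setSum_image_smul, Units.val_mk0]
  have h1 : ∑ c : ZMod p, setSum D (c • a) = (D.card : ℂ) + (p - 1) * setSum D a := by
    rw [← Finset.add_sum_erase _ _ (Finset.mem_univ 0), zero_smul, setSum_zero,
      Finset.sum_congr rfl fun c hc => hinv c (Finset.ne_of_mem_erase hc)]
    simp [hp.one_le]
  have h2 : ∑ c : ZMod p, setSum D (c • a) = p * (D.filter fun x => ip a x = 0).card := by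
    simp only [setSum, ip_smul_left, ← mul_neg]
    rw [Finset.sum_comm]
    simp only [sum_zetaP_mul, neg_eq_zero]
    rw [← Finset.sum_filter]
    simp [mul_comm]
  have hp1 : (p : ℂ) - 1 ≠ 0 := sub_ne_zero.2 (by exact_mod_cast hp.one_lt.ne')
  refine ⟨(p * (D.filter fun x => ip a x = 0).card - D.card) / (p - 1), ?_⟩
  push_cast
  rw [eq_div_iff hp1, ← h2, h1]
  ring

end Fourier

section PartialDifferenceSets

variable {p : ℕ} [Fact p.Prime] {n : ℕ}

theorem setSum_neg_of_symmetric {D : Finset (Fin n → ZMod p)} (hneg : ∀ x, -x ∈ D ↔ x ∈ D)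
    (a : Fin n → ZMod p) : setSum D (-a) = setSum D a := by
  refine Finset.sum_bij' (fun x _ => -x) (fun x _ => -x) ?_ ?_ ?_ ?_ ?_
  · exact fun x hx => (hneg x).2 hx
  · exact fun x hx => (hneg x).2 hx
  · simp
  · simp
  · intro x _
    rw [ip_eq_dotProduct, ip_eq_dotProduct, neg_dotProduct, dotProduct_neg]

theorem fourierSum_card_sub (D : Finset (Fin n → ZMod p)) (a : Fin n → ZMod p) :
    fourierSum (fun g => (((D ×ˢ D).filter fun dd => dd.1 - dd.2 = g).card : ℂ)) a =
      setSum D a * setSum D (-a) := by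
  rw [setSum, setSum, Finset.sum_mul_sum, ← Finset.sum_product',
    ← Finset.sum_fiberwise (D ×ˢ D) fun dd => dd.1 - dd.2]
  refine Finset.sum_congr rfl fun g _ => ?_
  rw [← nsmul_eq_mul, ← Finset.sum_const]
  refine Finset.sum_congr rfl fun dd hdd => ?_
  rw [← (Finset.mem_filter.1 hdd).2, ← zetaP_add, ip_sub_right, ip_eq_dotProduct (-a),
    neg_dotProduct, ← ip_eq_dotProduct]
  congr 1
  ring

/-- A symmetric set without `0` is a partial difference set iff its character sums satisfy the
associated quadratic equation. -/
theorem isPDS_iff_setSum {D : Finset (Fin n → ZMod p)} (h0 : 0 ∉ D)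
    (hneg : ∀ x, -x ∈ D ↔ x ∈ D) (k l m : ℤ) :
    IsPDS D ((p : ℤ) ^ n) (k, l, m) ↔ (D.card : ℤ) = k ∧ ∀ a,
      setSum D a ^ 2 =
        (k - m) + (l - m) * setSum D a + if a = 0 then (m : ℂ) * (p : ℂ) ^ n else 0 := by
  set N : (Fin n → ZMod p) → ℂ :=
    fun g => (((D ×ˢ D).filter fun dd => dd.1 - dd.2 = g).card : ℂ) with hN
  set M : (Fin n → ZMod p) → ℂ :=
    fun g => ((k : ℂ) - m) * (if g ∈ ({0} : Finset (Fin n → ZMod p)) then 1 else 0) +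
      ((l : ℂ) - m) * (if g ∈ D then 1 else 0) +
      (m : ℂ) * (if g ∈ (Finset.univ : Finset (Fin n → ZMod p)) then 1 else 0) with hM
  have hNF (a) : fourierSum N a = setSum D a ^ 2 := by
    rw [fourierSum_card_sub, setSum_neg_of_symmetric hneg, sq]
  have hMF (a) : fourierSum M a =
      (k - m) + (l - m) * setSum D a + if a = 0 then (m : ℂ) * (p : ℂ) ^ n else 0 := by
    have h1 : fourierSum M a = (k - m) * setSum {0} a + (l - m) * setSum D a +
        m * setSum Finset.univ a := by
      simp only [← fourierSum_indicator]
      simp only [fourierSum, Finset.mul_sum, ← Finset.sum_add_distrib, hM]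
      exact Finset.sum_congr rfl fun x _ => by ring
    rw [h1, setSum_univ]
    simp [setSum, ip_zero_right, zetaP_zero]
  have hN0 : N 0 = D.card := by
    rw [hN, ← Finset.diag_card D]
    refine congrArg (fun S : Finset _ => (S.card : ℂ)) (Finset.ext ?_)
    rintro ⟨x, y⟩
    simp only [Finset.mem_filter, Finset.mem_product, sub_eq_zero, Finset.mem_diag]
    constructor
    · rintro ⟨⟨hx, -⟩, h⟩
      exact ⟨hx, h⟩
    · rintro ⟨hx, h⟩
      exact ⟨⟨hx, h ▸ hx⟩, h⟩
  have hcard : (Fintype.card (Fin n → ZMod p) : ℤ) = (p : ℤ) ^ n := by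
    simp [ZMod.card]
  simp only [← hMF, ← hNF, ← funext_iff, fourierSum_injective.eq_iff]
  constructor
  · rintro ⟨-, hk, hl, hm⟩
    refine ⟨hk, funext fun g => ?_⟩
    by_cases hg0 : g = 0
    · rw [hg0, hN0]
      simp only at hk
      simp [hM, h0, ← hk]
    · by_cases hg : g ∈ D
      · have := hl g hg hg0
        simp only at this
        simp [hN, hM, hg, hg0, ← this]
      · have := hm g hg hg0
        simp only at this
        simp [hN, hM, hg, hg0, ← this]
  · rintro ⟨hk, h⟩
    refine ⟨hcard, hk, fun g hg hg0 => ?_, fun g hg hg0 => ?_⟩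
    · have := congrFun h g
      simp only [hN, hM, hg, hg0, Finset.mem_singleton, if_true, if_false, Finset.mem_univ] at this
      rw [← Int.cast_inj (α := ℂ), Int.cast_natCast]
      linear_combination this
    · have := congrFun h g
      simp only [hN, hM, hg, hg0, Finset.mem_singleton, if_true, if_false, Finset.mem_univ] at this
      rw [← Int.cast_inj (α := ℂ), Int.cast_natCast]
      linear_combination this

/-- A symmetric set has the parameters `param35` or `param36` iff it has the right size and its nontrivial
character sums take the two prescribed values. -/
theorem isPDS_params_iff {s : ℕ} (hneven : Even n) (hsn : s ≤ n / 2) {ε : ℤ}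
    (hε : ε = 1 ∨ ε = -1) {E : Finset (Fin n → ZMod p)} (hneg : ∀ x, -x ∈ E ↔ x ∈ E) (c : ℤ) :
    ((0 ∈ E → IsPDS (E.erase 0) ((p : ℤ) ^ n) (param35 p n s ε c)) ∧
      (0 ∉ E → IsPDS (E.erase 0) ((p : ℤ) ^ n) (param36 p n s ε c))) ↔
    (E.card : ℂ) = (p : ℂ) ^ (n - s) * c - ε * (p : ℂ) ^ (n / 2 - s) * c +
        (if 0 ∈ E then ε * (p : ℂ) ^ (n / 2) else 0) ∧
      ∀ a ≠ 0, (setSum E a - ε * (p : ℂ) ^ (n / 2 - s) * ((p : ℂ) ^ s - c)) *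
        (setSum E a + ε * (p : ℂ) ^ (n / 2 - s) * c) = 0 := by
  obtain ⟨r, hr⟩ : ∃ r, n / 2 = s + r := ⟨n / 2 - s, by omega⟩
  have hn2 : n = 2 * (n / 2) := by have := Nat.even_iff.1 hneven; omega
  have e1 : n / 2 - s = r := by omega
  have e2 : n - s = s + 2 * r := by omega
  have e3 : n - 2 * s = 2 * r := by omega
  have e4 : n = 2 * s + 2 * r := by omega
  have hε2 : (ε : ℂ) ^ 2 = 1 := by rcases hε with rfl | rfl <;> norm_num
  have hnegE : ∀ x, -x ∈ E.erase 0 ↔ x ∈ E.erase 0 := by simp [hneg]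
  have hpn : (p : ℂ) ^ n = (p : ℂ) ^ (2 * s + 2 * r) := by rw [← e4]
  rw [param35, param36, isPDS_iff_setSum (by simp) hnegE, isPDS_iff_setSum (by simp) hnegE]
  rw [e1, e2, e3, hr, hpn]
  have hiff {X Y : Prop} {P Q : (Fin n → ZMod p) → Prop} (hXY : X ↔ Y) (h0 : X → P 0)
      (h : ∀ a ≠ 0, (P a ↔ Q a)) : (X ∧ ∀ a, P a) ↔ (Y ∧ ∀ a ≠ 0, Q a) := by
    refine ⟨fun hP => ⟨hXY.1 hP.1, fun a ha => (h a ha).1 (hP.2 a)⟩, fun hQ => ?_⟩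
    have hX := hXY.2 hQ.1
    refine ⟨hX, fun a => ?_⟩
    by_cases ha : a = 0
    · exact ha ▸ h0 hX
    · exact (h a ha).2 (hQ.2 a ha)
  have hcoeff := congrArg (fun z : ℂ => (p : ℂ) ^ (2 * r) * ((p : ℂ) ^ s - c) * c * (z - 1)) hε2
  by_cases h0 : (0 : Fin n → ZMod p) ∈ E
  · simp only [h0, not_true_eq_false, false_imp_iff, and_true, true_imp_iff, if_true]
    have hcE : (((E.erase 0).card : ℤ) : ℂ) = (E.card : ℂ) - 1 := by
      rw [← Finset.card_erase_add_one h0]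
      push_cast
      ring
    rw [← Int.cast_inj (α := ℂ), hcE]
    simp only [setSum_erase_zero h0]
    push_cast
    refine hiff ⟨fun h => ?_, fun h => ?_⟩ (fun h => ?_) fun a ha => ⟨fun h => ?_, fun h => ?_⟩
    · linear_combination h
    · linear_combination h
    · rw [setSum_zero, h, if_pos rfl]
      linear_combination hcoeff
    · rw [if_neg ha] at h
      linear_combination h - hcoeff
    · rw [if_neg ha]
      linear_combination h + hcoeff
  · simp only [h0, not_false_eq_true, false_imp_iff, true_and, true_imp_iff, if_false,
      Finset.erase_eq_of_notMem]
    rw [← Int.cast_inj (α := ℂ)]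
    push_cast
    refine hiff ⟨fun h => ?_, fun h => ?_⟩ (fun h => ?_) fun a ha => ⟨fun h => ?_, fun h => ?_⟩
    · linear_combination h
    · linear_combination h
    · rw [setSum_zero, h, if_pos rfl]
      linear_combination hcoeff
    · rw [if_neg ha] at h
      linear_combination h - hcoeff
    · rw [if_neg ha]
      linear_combination h + hcoeff

end PartialDifferenceSets

section Peaks

theorem sum_fiber_comp_swap {ι κ : Type*} [Fintype ι] [DecidableEq ι] [DecidableEq κ]
    (g : ι → κ) (c : ι → ℚ) {x y : ι} (hxy : g x ≠ g y) (j : κ) :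
    ∑ i with g (Equiv.swap x y i) = j, c i = ∑ i with g i = j, c i +
      (if j = g x then c y - c x else 0) + (if j = g y then c x - c y else 0) := by
  have hne : x ≠ y := fun h => hxy (h ▸ rfl)
  have h1 : ∑ i with g (Equiv.swap x y i) = j, c i =
      ∑ i with g i = j, c (Equiv.swap x y i) := by
    rw [Finset.sum_filter, Finset.sum_filter, ← Equiv.sum_comp (Equiv.swap x y)]
    simp
  have h2 (i : ι) : c (Equiv.swap x y i) =
      c i + (if i = x then c y - c x else 0) + (if i = y then c x - c y else 0) := by
    by_cases hx : i = x
    · subst hx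
      simp [hne]
    · by_cases hy : i = y
      · subst hy
        simp [hx]
      · simp [hx, hy, Equiv.swap_apply_of_ne_of_ne hx hy]
  rw [h1]
  simp only [h2, Finset.sum_add_distrib, Finset.sum_ite_eq', Finset.mem_filter,
    Finset.mem_univ, true_and, eq_comm (a := j)]

/-- If the sums of `c` over the fibres of every balanced function agree up to a single fibre
exceeding by `K`, then the values of `c` agree up to a single one exceeding by `K`. -/
theorem exists_peak_of_balanced {ι : Type*} [Fintype ι] [DecidableEq ι] {p N : ℕ}
    [Fact p.Prime] (hp : 2 < p) (hN : 0 < N) {c : ι → ℚ} {B K : ℚ} (hK : K ≠ 0)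
    {g : ι → ZMod p} (hg : ∀ j, (Finset.univ.filter fun i => g i = j).card = N)
    (h : ∀ g : ι → ZMod p, (∀ j, (Finset.univ.filter fun i => g i = j).card = N) →
      ∃ j₀, ∀ j, ∑ i with g i = j, c i = B + if j = j₀ then K else 0) :
    ∃ i₀ u, ∀ i, c i = u + if i = i₀ then K else 0 := by
  obtain ⟨j₀, hj₀⟩ := h g hg
  have hswap (x y : ι) : ∃ j₁, ∀ j,
      ∑ i with g (Equiv.swap x y i) = j, c i = B + if j = j₁ then K else 0 := by
    refine h _ fun j => ?_
    rw [← hg j]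
    refine Finset.card_bij' (fun i _ => Equiv.swap x y i) (fun i _ => Equiv.swap x y i)
      ?_ ?_ ?_ ?_ <;> simp
  have hflat {x y : ι} (hx : g x ≠ j₀) (hy : g y ≠ j₀) (hxy : g x ≠ g y) : c x = c y := by
    obtain ⟨j₁, hj₁⟩ := hswap x y
    have h0 := hj₁ j₀
    have h1 := hj₁ (g x)
    rw [sum_fiber_comp_swap g c hxy, hj₀] at h0 h1
    have hj : j₀ = j₁ := by
      by_contra hne
      simp [hx.symm, hy.symm, hne, hK] at h0
    subst hj
    simp [hx, hxy] at h1
    linarith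
  have hpeak {x y : ι} (hx : g x = j₀) (hy : g y ≠ j₀) : c x = c y ∨ c x = c y + K := by
    obtain ⟨j₁, hj₁⟩ := hswap x y
    have h1 := hj₁ j₀
    rw [sum_fiber_comp_swap g c (fun h => hy (h ▸ hx)), hj₀] at h1
    by_cases hj : j₀ = j₁
    · left
      simp [hx, hj] at h1
      subst hj
      simp [hy.symm] at h1
      linarith
    · right
      simp [hx, hy.symm, hj] at h1
      linarith
  have hfiber (j : ZMod p) : ∃ x, g x = j := by
    obtain ⟨x, hx⟩ := Finset.card_pos.1 ((hg j).symm ▸ hN)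
    exact ⟨x, (Finset.mem_filter.1 hx).2⟩
  have hthird (j : ZMod p) : ∃ k, k ≠ j₀ ∧ k ≠ j := by
    obtain ⟨k, hk⟩ := Finset.exists_mem_notMem_of_card_lt_card
      (s := {j₀, j}) (t := (Finset.univ : Finset (ZMod p)))
      (by rw [Finset.card_univ, ZMod.card]; exact Finset.card_le_two.trans_lt hp)
    simp only [Finset.mem_insert, Finset.mem_singleton, not_or] at hk
    exact ⟨k, hk.2⟩
  obtain ⟨k, hk, -⟩ := hthird j₀
  obtain ⟨y, rfl⟩ := hfiber k
  have hoff {x : ι} (hx : g x ≠ j₀) : c x = c y := by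
    by_cases hxy : g x = g y
    · obtain ⟨l, hl, hly⟩ := hthird (g y)
      obtain ⟨z, rfl⟩ := hfiber l
      rw [hflat hx hl (hxy ▸ hly.symm), hflat hl hk hly]
    · exact hflat hx hk hxy
  have hB : B = N * c y := by
    have h1 := hj₀ (g y)
    rw [if_neg hk, add_zero, Finset.sum_congr rfl (g := fun _ => c y), Finset.sum_const, hg,
      nsmul_eq_mul] at h1
    · exact h1.symm
    · intro x hx
      exact hoff ((Finset.mem_filter.1 hx).2 ▸ hk)
  have hval (x : ι) : c x = c y + if c x ≠ c y then K else 0 := by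
    by_cases hx : g x = j₀
    · rcases hpeak hx hk with h1 | h1
      · simp [h1]
      · simp [h1, hK]
    · simp [hoff hx]
  have hone : (Finset.univ.filter fun x => c x ≠ c y).card = 1 := by
    have h1 := hj₀ j₀
    rw [if_pos rfl, Finset.sum_congr rfl fun x _ => hval x, Finset.sum_add_distrib,
      Finset.sum_const, hg, nsmul_eq_mul, ← hB, add_right_inj, ← Finset.sum_filter,
      Finset.sum_const, nsmul_eq_mul, Finset.filter_filter] at h1
    have h2 := mul_right_cancel₀ hK (h1.trans (one_mul K).symm)
    rw [← Nat.cast_inj (R := ℚ), Nat.cast_one, ← h2]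
    congr 2
    ext x
    simp only [Finset.mem_filter, Finset.mem_univ, true_and]
    exact ⟨fun hx => ⟨by_contra fun hgx => hx (hoff hgx), hx⟩, fun hx => hx.2⟩
  obtain ⟨i₀, hi₀⟩ := Finset.card_eq_one.1 hone
  refine ⟨i₀, c y, fun x => ?_⟩
  have hiff : c x ≠ c y ↔ x = i₀ := by
    have := Finset.ext_iff.1 hi₀ x
    simpa using this
  rw [hval x]
  simp [hiff]

end Peaks

section BentPartitions

variable {p : ℕ} [Fact p.Prime] {n s : ℕ} {ε : ℤ}
  {A : (Fin s → ZMod p) → Finset (Fin n → ZMod p)} {F : (Fin n → ZMod p) → Fin s → ZMod p}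

/-- The character sums of the parts of `A` are constant in the part, up to the single part
indexed by `G a`, which exceeds the others by `ε p^(n/2)`. -/
def HasPeakSpectrum (ε : ℤ) (A : (Fin s → ZMod p) → Finset (Fin n → ZMod p))
    (G : (Fin n → ZMod p) → Fin s → ZMod p) : Prop :=
  ∀ a i, setSum (A i) a = (if a = 0 then (p : ℂ) ^ (n - s) else 0) +
    (if i = G a then (ε : ℂ) * (p : ℂ) ^ (n / 2) else 0) - ε * (p : ℂ) ^ (n / 2 - s)

theorem card_filter_coord (hs : 0 < s) (j : ZMod p) :
    (Finset.univ.filter fun i : Fin s → ZMod p => i ⟨0, hs⟩ = j).card = p ^ (s - 1) := by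
  have h := Fintype.card_filter_piFinset_const_eq_of_mem (Finset.univ : Finset (ZMod p))
    (⟨0, hs⟩ : Fin s) (Finset.mem_univ j)
  rwa [Fintype.piFinset_univ, Finset.card_univ, ZMod.card, Fintype.card_fin] at h

theorem sum_zetaP_eq_zero_of_balanced {ι : Type*} [Fintype ι] {N : ℕ} {g : ι → ZMod p}
    (hg : ∀ j, (Finset.univ.filter fun i => g i = j).card = N) : ∑ i, zetaP p (g i) = 0 := by
  rw [← Finset.sum_fiberwise Finset.univ g]
  have h (j : ZMod p) : ∑ i with g i = j, zetaP p (g i) = N * zetaP p j := by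
    rw [Finset.sum_congr rfl (g := fun _ => zetaP p j), Finset.sum_const, hg, nsmul_eq_mul]
    intro i hi
    rw [(Finset.mem_filter.1 hi).2]
  simp only [h]
  rw [← Finset.mul_sum, sum_zetaP, mul_zero]

theorem walsh_comp (hFA : ∀ x i, F x = i ↔ x ∈ A i) (g : (Fin s → ZMod p) → ZMod p)
    (a : Fin n → ZMod p) :
    walsh (fun x => g (F x)) a = ∑ i, zetaP p (g i) * setSum (A i) a := by
  rw [walsh, ← Finset.sum_fiberwise Finset.univ F]
  refine Finset.sum_congr rfl fun i _ => ?_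
  rw [setSum, Finset.mul_sum]
  have hfiber : (Finset.univ.filter fun x => F x = i) = A i := by
    ext x
    simp [hFA]
  rw [hfiber]
  refine Finset.sum_congr rfl fun x hx => ?_
  rw [(hFA x i).2 hx, sub_eq_add_neg, zetaP_add]

theorem pairwise_disjoint_of_fibers {α ι : Type*} {A : ι → Finset α} {F : α → ι}
    (hFA : ∀ x i, F x = i ↔ x ∈ A i) :
    Pairwise fun i j => Disjoint (A i) (A j) := by
  intro i j hij
  rw [Finset.disjoint_left]
  intro x hi hj
  exact hij (((hFA x i).2 hi).symm.trans ((hFA x j).2 hj))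

theorem sum_setSum_fibers (hFA : ∀ x i, F x = i ↔ x ∈ A i) (a : Fin n → ZMod p) :
    ∑ i, setSum (A i) a = if a = 0 then (p : ℂ) ^ n else 0 := by
  rw [← setSum_univ, ← setSum_biUnion (pairwise_disjoint_of_fibers hFA)]
  congr 1
  ext x
  simp [← hFA]

theorem HasPeakSpectrum.image_smul_eq {G : (Fin n → ZMod p) → Fin s → ZMod p}
    (hG : HasPeakSpectrum ε A G) (u : (ZMod p)ˣ) (i : Fin s → ZMod p) :
    ((A i).image fun x => (u : ZMod p) • x) = A i := by
  refine image_smul_eq_of_setSum_rat (fun a => ?_) u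
  refine ⟨(if a = 0 then (p : ℚ) ^ (n - s) else 0) +
    (if i = G a then (ε : ℚ) * (p : ℚ) ^ (n / 2) else 0) - ε * (p : ℚ) ^ (n / 2 - s), ?_⟩
  rw [hG]
  split_ifs <;> push_cast <;> rfl

theorem HasPeakSpectrum.weaklyRegularBent {G : (Fin n → ZMod p) → Fin s → ZMod p}
    (hFA : ∀ x i, F x = i ↔ x ∈ A i) (hG : HasPeakSpectrum ε A G) {N : ℕ}
    {g : (Fin s → ZMod p) → ZMod p}
    (hg : ∀ j, (Finset.univ.filter fun i => g i = j).card = N) :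
    WeaklyRegularBent p (fun x => g (F x)) ε := by
  refine ⟨fun a => g (G a), fun a => ?_⟩
  rw [walsh_comp hFA]
  simp only [hG a, mul_sub, mul_add, Finset.sum_sub_distrib, Finset.sum_add_distrib,
    ← Finset.sum_mul, sum_zetaP_eq_zero_of_balanced hg]
  simp [mul_comm]

theorem neg_mem_iff_of_image_smul_eq {D : Finset (Fin n → ZMod p)}
    (h : ∀ u : (ZMod p)ˣ, (D.image fun x => (u : ZMod p) • x) = D) (x : Fin n → ZMod p) :
    -x ∈ D ↔ x ∈ D := by
  have hmem {y : Fin n → ZMod p} (hy : y ∈ D) : -y ∈ D := by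
    rw [← h (-1)]
    exact Finset.mem_image.2 ⟨y, hy, by simp⟩
  exact ⟨fun hx => neg_neg x ▸ hmem hx, hmem⟩

theorem even_card_erase_zero (hodd : Odd p) {D : Finset (Fin n → ZMod p)}
    (hneg : ∀ x, -x ∈ D ↔ x ∈ D) : Even (D.erase 0).card := by
  have hp2 : (2 : ZMod p) ≠ 0 := by
    have h := (ZMod.natCast_eq_zero_iff 2 p).not.2 fun hdvd => by
      have h2 := (Nat.prime_dvd_prime_iff_eq Fact.out Nat.prime_two).1 hdvd
      rw [h2] at hodd
      exact absurd hodd (by decide)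
    exact_mod_cast h
  rw [← ZMod.natCast_eq_zero_iff_even, Finset.cast_card]
  refine Finset.sum_involution (fun x _ => -x) ?_ ?_ ?_ ?_
  · exact fun _ _ => by decide
  · intro x hx _ h
    refine (Finset.mem_erase.1 hx).1 (funext fun i => ?_)
    have hi : 2 * x i = 0 := by
      have := congrFun h i
      simp only [Pi.neg_apply] at this
      linear_combination -this
    simpa [hp2] using hi
  · intro x hx
    simpa [hneg] using hx
  · exact fun x _ => neg_neg x

/-- A bent partition satisfying Condition C has a peak spectrum. -/
theorem exists_hasPeakSpectrum_of_bent (hodd : Odd p) (hneven : Even n) (hs : 0 < s)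
    (hsn : s ≤ n / 2) (hε : ε = 1 ∨ ε = -1) (hFA : ∀ x i, F x = i ↔ x ∈ A i)
    (hscale : ∀ (u : (ZMod p)ˣ) (i), ((A i).image fun x => (u : ZMod p) • x) = A i)
    (hbent : ∀ g : (Fin s → ZMod p) → ZMod p,
      (∀ j : ZMod p, (Finset.univ.filter fun i => g i = j).card = p ^ (s - 1)) →
      WeaklyRegularBent p (fun x => g (F x)) ε) :
    ∃ G, HasPeakSpectrum ε A G ∧ G 0 = F 0 := by
  have hp : p.Prime := Fact.out
  have hp2 : 2 < p := lt_of_le_of_ne hp.two_le (by rintro rfl; exact absurd hodd (by decide))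
  obtain ⟨r, hr⟩ : ∃ r, n / 2 = s + r := ⟨n / 2 - s, by omega⟩
  have hn2 : n = 2 * (n / 2) := by have := Nat.even_iff.1 hneven; omega
  have e1 : n / 2 - s = r := by omega
  have e2 : n - s = s + 2 * r := by omega
  have e4 : (p : ℚ) ^ n = (p : ℚ) ^ (2 * s + 2 * r) := by congr 1; omega
  have hp0 : (p : ℚ) ≠ 0 := Nat.cast_ne_zero.2 hp.ne_zero
  choose c hc using fun a i => exists_rat_setSum (fun u => hscale u i) a
  set K : ℚ := ε * (p : ℚ) ^ (n / 2) with hKdef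
  have hK : K ≠ 0 := by
    refine mul_ne_zero ?_ (pow_ne_zero _ hp0)
    rcases hε with rfl | rfl <;> norm_num
  have hcsum (a) : ∑ i, c a i = if a = 0 then (p : ℚ) ^ n else 0 := by
    have h := sum_setSum_fibers hFA a
    simp only [hc] at h
    rw [← Rat.cast_inj (α := ℂ), Rat.cast_sum, h]
    split_ifs <;> push_cast <;> rfl
  have hpeak (a) : ∃ i₀ u, ∀ i, c a i = u + if i = i₀ then K else 0 := by
    refine exists_peak_of_balanced (N := p ^ (s - 1)) (B := (∑ i, c a i - K) / p) hp2
      (pow_pos hp.pos _) hK (card_filter_coord hs) fun g hg => ?_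
    obtain ⟨fd, hfd⟩ := hbent g hg
    refine ⟨fd a, fun j => ?_⟩
    set S : ZMod p → ℚ := fun j => ∑ i with g i = j, c a i with hS
    have hwalsh : ∑ j, (S j : ℂ) * zetaP p j = (K : ℂ) * zetaP p (fd a) := by
      have h := hfd a
      rw [walsh_comp hFA, ← Finset.sum_fiberwise Finset.univ g] at h
      rw [hKdef]
      push_cast
      rw [← h]
      refine Finset.sum_congr rfl fun j _ => ?_
      rw [hS]
      push_cast
      rw [Finset.sum_mul]
      refine Finset.sum_congr rfl fun i hi => ?_
      rw [(Finset.mem_filter.1 hi).2, hc, mul_comm]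
    set d : ZMod p → ℚ := fun j => S j - if j = fd a then K else 0 with hd
    have hrel : ∑ j, (d j : ℂ) * zetaP p j = 0 := by
      simp [hd, sub_mul, Finset.sum_sub_distrib, hwalsh, apply_ite (Rat.cast : ℚ → ℂ)]
    have hconst (k : ZMod p) : d k = d j := eq_of_sum_zetaP_eq_zero hrel k j
    have htotal : ∑ k, d k = ∑ i, c a i - K := by
      simp only [hd, Finset.sum_sub_distrib, hS]
      rw [Finset.sum_fiberwise Finset.univ g]
      simp
    rw [Finset.sum_congr rfl fun k _ => hconst k] at htotal
    simp only [Finset.sum_const, Finset.card_univ, ZMod.card, nsmul_eq_mul] at htotal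
    rw [← htotal, mul_div_cancel_left₀ _ hp0]
    simp [hd, hS]
  choose G u hGu using hpeak
  have hu (a) : u a = (if a = 0 then (p : ℚ) ^ (n - s) else 0) - ε * (p : ℚ) ^ (n / 2 - s) := by
    have h := hcsum a
    simp only [hGu, Finset.sum_add_distrib, Finset.sum_const, Finset.card_univ,
      Finset.sum_ite_eq', Finset.mem_univ, if_true, Fintype.card_pi, Finset.prod_const,
      ZMod.card, Fintype.card_fin, nsmul_eq_mul] at h
    refine mul_left_cancel₀ (pow_ne_zero s hp0) ?_
    rw [hKdef, hr, e4] at h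
    rw [e1, e2]
    push_cast at h
    by_cases ha : a = 0
    · simp only [ha, if_true] at h ⊢
      linear_combination h
    · simp only [ha, if_false] at h ⊢
      linear_combination h
  have hG : HasPeakSpectrum ε A G := by
    intro a i
    rw [hc, hGu, hu, hKdef]
    split_ifs <;> push_cast <;> ring
  refine ⟨G, hG, ?_⟩
  by_contra hne
  have hcard : ((A (F 0)).card : ℤ) = (p : ℤ) ^ (n - s) - ε * (p : ℤ) ^ (n / 2 - s) := by
    have h := hG 0 (F 0)
    rw [setSum_zero, if_pos rfl, if_neg (Ne.symm hne), add_zero] at h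
    exact_mod_cast h
  have heven : Even ((A (F 0)).card : ℤ) := by
    have hpZ : Odd (p : ℤ) := by exact_mod_cast hodd
    rw [hcard]
    refine Odd.sub_odd hpZ.pow (Odd.mul ?_ hpZ.pow)
    rcases hε with rfl | rfl <;> decide
  have h0 : (0 : Fin n → ZMod p) ∈ A (F 0) := (hFA 0 (F 0)).1 rfl
  have herase := even_card_erase_zero hodd
    (neg_mem_iff_of_image_smul_eq fun u => hscale u (F 0))
  have hnat : Even (A (F 0)).card := by exact_mod_cast heven
  rw [← Finset.card_erase_add_one h0] at hnat
  exact absurd hnat (Nat.not_even_iff_odd.2 herase.add_one)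

/-- If every part is a partial difference set with parameters `param35` or `param36`, then the partition
has a peak spectrum. -/
theorem exists_hasPeakSpectrum_of_isPDS (hneven : Even n) (hsn : s ≤ n / 2)
    (hε : ε = 1 ∨ ε = -1) (hFA : ∀ x i, F x = i ↔ x ∈ A i)
    (hneg : ∀ i x, -x ∈ A i ↔ x ∈ A i)
    (hPDS : ∀ i,
      (0 ∈ A i → IsPDS ((A i).erase 0) ((p : ℤ) ^ n) (param35 p n s ε 1)) ∧
      (0 ∉ A i → IsPDS ((A i).erase 0) ((p : ℤ) ^ n) (param36 p n s ε 1))) :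
    ∃ G, HasPeakSpectrum ε A G := by
  have hp : p.Prime := Fact.out
  have hp0 : (p : ℂ) ≠ 0 := Nat.cast_ne_zero.2 hp.ne_zero
  have hspec := fun i => (isPDS_params_iff hneven hsn hε (hneg i) 1).1 (hPDS i)
  have hpow : (p : ℂ) ^ (n / 2) = (p : ℂ) ^ (n / 2 - s) * (p : ℂ) ^ s := by
    rw [← pow_add, Nat.sub_add_cancel hsn]
  have hK : (ε : ℂ) * (p : ℂ) ^ (n / 2) ≠ 0 := by
    refine mul_ne_zero ?_ (pow_ne_zero _ hp0)
    rcases hε with rfl | rfl <;> norm_num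
  suffices h : ∀ a, ∃ i₀, ∀ i, setSum (A i) a = (if a = 0 then (p : ℂ) ^ (n - s) else 0) +
      (if i = i₀ then (ε : ℂ) * (p : ℂ) ^ (n / 2) else 0) - ε * (p : ℂ) ^ (n / 2 - s) by
    choose G hG using h
    exact ⟨G, hG⟩
  intro a
  by_cases ha : a = 0
  · refine ⟨F 0, fun i => ?_⟩
    rw [ha, setSum_zero, (hspec i).1]
    simp only [← hFA, eq_comm (a := i), if_true]
    push_cast
    ring
  · set T : Finset (Fin s → ZMod p) :=
      Finset.univ.filter fun i => setSum (A i) a + ε * (p : ℂ) ^ (n / 2 - s) ≠ 0 with hT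
    have hval (i) : setSum (A i) a =
        (if i ∈ T then (ε : ℂ) * (p : ℂ) ^ (n / 2) else 0) - ε * (p : ℂ) ^ (n / 2 - s) := by
      have h := (hspec i).2 a ha
      push_cast at h
      rw [mul_one] at h
      by_cases hi : setSum (A i) a + ε * (p : ℂ) ^ (n / 2 - s) = 0
      · simp only [hT, Finset.mem_filter, hi, ne_eq, not_true_eq_false, and_false, if_false]
        linear_combination hi
      · have h1 := (mul_eq_zero.1 h).resolve_right hi
        simp only [hT, Finset.mem_filter, hi, ne_eq, not_false_eq_true, Finset.mem_univ,
          and_true, if_true]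
        rw [hpow]
        linear_combination h1
    have hcard : T.card = 1 := by
      have h := sum_setSum_fibers hFA a
      simp only [hval, Finset.sum_sub_distrib, Finset.sum_ite_mem, Finset.univ_inter,
        Finset.sum_const, Finset.card_univ, Fintype.card_pi, Finset.prod_const, ZMod.card,
        Fintype.card_fin, nsmul_eq_mul, if_neg ha] at h
      push_cast at h
      have h1 : (T.card : ℂ) = 1 := by
        refine mul_right_cancel₀ hK ?_
        rw [hpow] at h ⊢
        linear_combination h
      exact_mod_cast h1
    obtain ⟨i₀, hi₀⟩ := Finset.card_eq_one.1 hcard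
    refine ⟨i₀, fun i => ?_⟩
    rw [hval i, hi₀, if_neg ha, zero_add]
    simp only [Finset.mem_singleton]

/-- If the partition has a peak spectrum, then the unions of its parts are partial difference
sets with parameters `param35` or `param36`. -/
theorem HasPeakSpectrum.isPDS {G : (Fin n → ZMod p) → Fin s → ZMod p} (hneven : Even n)
    (hsn : s ≤ n / 2) (hε : ε = 1 ∨ ε = -1) (hFA : ∀ x i, F x = i ↔ x ∈ A i)
    (hG : HasPeakSpectrum ε A G) (hG0 : G 0 = F 0) {I : Finset (Fin s → ZMod p)}
    (hneg : ∀ x, -x ∈ I.biUnion A ↔ x ∈ I.biUnion A) :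
    (0 ∈ I.biUnion A →
      IsPDS ((I.biUnion A).erase 0) ((p : ℤ) ^ n) (param35 p n s ε I.card)) ∧
    (0 ∉ I.biUnion A →
      IsPDS ((I.biUnion A).erase 0) ((p : ℤ) ^ n) (param36 p n s ε I.card)) := by
  have hpow : (p : ℂ) ^ (n / 2) = (p : ℂ) ^ (n / 2 - s) * (p : ℂ) ^ s := by
    rw [← pow_add, Nat.sub_add_cancel hsn]
  have hsum (a) : setSum (I.biUnion A) a =
      I.card * (if a = 0 then (p : ℂ) ^ (n - s) else 0) +
      (if G a ∈ I then (ε : ℂ) * (p : ℂ) ^ (n / 2) else 0) -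
      I.card * (ε * (p : ℂ) ^ (n / 2 - s)) := by
    rw [setSum_biUnion (pairwise_disjoint_of_fibers hFA)]
    simp only [hG a, Finset.sum_sub_distrib, Finset.sum_add_distrib, Finset.sum_const,
      nsmul_eq_mul, Finset.sum_ite_eq']
  rw [isPDS_params_iff hneven hsn hε hneg]
  push_cast
  refine ⟨?_, fun a ha => ?_⟩
  · have hmem : (0 : Fin n → ZMod p) ∈ I.biUnion A ↔ G 0 ∈ I := by
      simp [← hFA, hG0]
    rw [← setSum_zero, hsum, if_pos rfl]
    simp only [hmem]
    ring
  · rw [hsum, if_neg ha, hpow]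
    by_cases hI : G a ∈ I
    · rw [if_pos hI]
      ring
    · rw [if_neg hI]
      ring

end BentPartitions

theorem stmt15 (p : ℕ) [Fact p.Prime] (hodd : Odd p) (n s : ℕ) (hn : 0 < n) (hneven : Even n)
    (hs : 0 < s) (hsn : s ≤ n / 2) (ε : ℤ) (hε : ε = 1 ∨ ε = -1)
    -- a partition of `V_n` into nonempty sets `A i`, with `F x = i ↔ x ∈ A i`
    (A : (Fin s → ZMod p) → Finset (Fin n → ZMod p))
    (hA : ∀ i, (A i).Nonempty)
    (F : (Fin n → ZMod p) → (Fin s → ZMod p))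
    (hFA : ∀ x i, F x = i ↔ x ∈ A i) :
    -- (1) the partition is a bent partition satisfying Condition C with sign ε
    ((∀ (a : (ZMod p)ˣ) (i : Fin s → ZMod p),
        (A i).image (fun x => (a : ZMod p) • x) = A i) ∧
      ∀ g : (Fin s → ZMod p) → ZMod p,
        (∀ j : ZMod p, (Finset.univ.filter (fun i => g i = j)).card = p ^ (s - 1)) →
        WeaklyRegularBent p (fun x => g (F x)) ε)
    -- (2) if and only if every union of parts is symmetric and a partial difference set
    -- with parameters (35)/(36)
    ↔ (∀ I : Finset (Fin s → ZMod p), I.Nonempty →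
        (∀ x : Fin n → ZMod p, -x ∈ I.biUnion A ↔ x ∈ I.biUnion A) ∧
        ((0 : Fin n → ZMod p) ∈ I.biUnion A →
          IsPDS ((I.biUnion A).erase 0) ((p : ℤ) ^ n) (param35 p n s ε I.card)) ∧
        ((0 : Fin n → ZMod p) ∉ I.biUnion A →
          IsPDS ((I.biUnion A).erase 0) ((p : ℤ) ^ n) (param36 p n s ε I.card))) := by
  constructor
  · rintro ⟨hscale, hbent⟩ I -
    obtain ⟨G, hG, hG0⟩ :=
      exists_hasPeakSpectrum_of_bent hodd hneven hs hsn hε hFA hscale hbent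
    have hneg (x : Fin n → ZMod p) : -x ∈ I.biUnion A ↔ x ∈ I.biUnion A := by
      simp only [Finset.mem_biUnion, neg_mem_iff_of_image_smul_eq fun u => hscale u _]
    exact ⟨hneg, hG.isPDS hneven hsn hε hFA hG0 hneg⟩
  · intro h
    have hsingle := fun i => h {i} (Finset.singleton_nonempty i)
    simp only [Finset.singleton_biUnion, Finset.card_singleton, Nat.cast_one] at hsingle
    obtain ⟨G, hG⟩ := exists_hasPeakSpectrum_of_isPDS hneven hsn hε hFA
      (fun i => (hsingle i).1) fun i => (hsingle i).2
    exact ⟨hG.image_smul_eq, fun g hg => hG.weaklyRegularBent hFA hg⟩
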